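/- Let V ⊆ R_2 be a 3-dimensional subspace of quadrics in R = K[w,x,y,z] such that the space of linear syzygies of V, namely the kernel of the multiplication map R_1 ⊗_K V → R_3, is exactly 1-dimensional. Then there exist a linear form ℓ ∈ R_1, a 2-dimensional subspace U ⊆ R_1, and a quadric h ∈ R_2 such that V = ℓ·U + K·h, where h is divisible neither by ℓ nor by any nonzero element of U. -/

import Mathlib

open MvPolynomial

set_option synthInstance.maxHeartbeats 2000000
set_option maxHeartbeats 2000000

noncomputable section

/-- The Hilbert function of the graded quotient `R/I`, where
`R = K[x_1,...,x_n]`: the dimension of the image in `R/I` of the space of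
degree-`i` homogeneous forms. -/
def hilb (n : ℕ) (K : Type*) [Field K] (I : Ideal (MvPolynomial (Fin n) K)) (i : ℕ) : ℕ :=
  Module.finrank K
    ((homogeneousSubmodule (Fin n) K i).map (Ideal.Quotient.mkₐ K I).toLinearMap)

/-- The socle `(0 : A_+)` of `A = R/I`: the elements killed by (the images of)
all the variables, equivalently by the irrelevant maximal ideal. -/
def socleSub (n : ℕ) (K : Type*) [Field K] (I : Ideal (MvPolynomial (Fin n) K)) :
    Submodule K (MvPolynomial (Fin n) K ⧸ I) :=
  ⨅ k : Fin n, LinearMap.ker (LinearMap.mulLeft K (Ideal.Quotient.mk I (X k)))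

/-- A homogeneous (graded) ideal: one containing each homogeneous component of
each of its elements. -/
def IdealHomog {n : ℕ} {K : Type*} [Field K] (I : Ideal (MvPolynomial (Fin n) K)) : Prop :=
  ∀ f ∈ I, ∀ d : ℕ, homogeneousComponent d f ∈ I

/-- `R/I` is a graded Artinian Gorenstein quotient of `R = K[x_1,...,x_n]`
of socle degree `j`: `I` is homogeneous, `R/I` is finite dimensional over `K`
with 1-dimensional socle, and `j` is the top nonzero degree. -/
def IsAG (n : ℕ) (K : Type*) [Field K] (I : Ideal (MvPolynomial (Fin n) K)) (j : ℕ) : Prop :=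
  IdealHomog I ∧ FiniteDimensional K (MvPolynomial (Fin n) K ⧸ I) ∧
    Module.finrank K (socleSub n K I) = 1 ∧
    hilb n K I j ≠ 0 ∧ ∀ i, j < i → hilb n K I i = 0

/-- Macaulay's bound `c^{(d)}`: writing `c = C(k_d,d) + ... + C(k_1,1)` with
`k_d > k_d-1 > ... > k_1 ≥ 0` (the `d`-th Macaulay expansion, computed greedily),
`c^{(d)} = C(k_d+1,d+1) + ... + C(k_1+1,2)`; by convention `0^{(d)} = 0`. -/
def macB : ℕ → ℕ → ℕ
  | _, 0 => 0
  | c, (d+1) =>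
    if c = 0 then 0 else
      let k := Nat.findGreatest (fun k => Nat.choose k (d+1) ≤ c) (c + d + 1)
      Nat.choose (k+1) (d+2) + macB (c - Nat.choose k (d+1)) d

/-- `(t_0, ..., t_m)` is an O-sequence: `t_0 = 1` and `t_{i+1} ≤ t_i^{(i)}`
for `1 ≤ i ≤ m-1`. -/
def IsOSeq (t : ℕ → ℕ) (m : ℕ) : Prop :=
  t 0 = 1 ∧ ∀ i, 1 ≤ i → i + 1 ≤ m → t (i + 1) ≤ macB (t i) i

/-- `ΔH_{≤ m}` is an O-sequence: the first differences `ΔH_i = h_i - h_{i-1}`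
(with `ΔH_0 = 1`) are nonnegative for `i ≤ m`, and `(ΔH_0, ..., ΔH_m)` is an
O-sequence. -/
def DeltaOSeq (h : ℕ → ℕ) (m : ℕ) : Prop :=
  (∀ i, 1 ≤ i → i ≤ m → h (i - 1) ≤ h i) ∧
    IsOSeq (fun i => if i = 0 then 1 else h i - h (i - 1)) m

/-- The multiplication map `R_1 ⊗_K V → R` (whose image lies in `R_3` when
`V ⊆ R_2`), for `R = K[w,x,y,z]`. -/
def mulMap {K : Type*} [Field K] (V : Submodule K (MvPolynomial (Fin 4) K)) :
    TensorProduct K (homogeneousSubmodule (Fin 4) K 1) V →ₗ[K] MvPolynomial (Fin 4) K :=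
  TensorProduct.lift
    (((LinearMap.mul K (MvPolynomial (Fin 4) K)).comp
      (homogeneousSubmodule (Fin 4) K 1).subtype).compl₂ V.subtype)

/-- A nonzero linear form `c` admits a retraction `σ` of the ring killing `c` exactly. -/
lemma exists_retraction {K : Type*} [Field K] (c : MvPolynomial (Fin 4) K)
    (hc : c.IsHomogeneous 1) (hc0 : c ≠ 0) :
    ∃ (σ : MvPolynomial (Fin 4) K →ₐ[K] MvPolynomial (Fin 4) K)
      (lam : MvPolynomial (Fin 4) K →ₗ[K] K),
      σ c = 0 ∧ (∀ f, c ∣ f - σ f) ∧ ∀ f, f.IsHomogeneous 1 → σ f = f - C (lam f) * c := by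
  obtain ⟨d, hd⟩ := MvPolynomial.exists_coeff_ne_zero hc0
  let lam : MvPolynomial (Fin 4) K →ₗ[K] K := (coeff d c)⁻¹ • MvPolynomial.lcoeff K d
  have hlam : lam c = 1 := by simp [lam, hd]
  let σ : MvPolynomial (Fin 4) K →ₐ[K] MvPolynomial (Fin 4) K :=
    aeval (fun i => X i - C (lam (X i)) * c)
  have hlin : ∀ f, f.IsHomogeneous 1 → σ f = f - C (lam f) * c := by
    intro f hf
    have hf' : f ∈ Submodule.span K (Set.range (X : Fin 4 → MvPolynomial (Fin 4) K)) := by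
      rw [← homogeneousSubmodule_one_eq_span_X]; exact hf
    induction hf' using Submodule.span_induction with
    | mem x hx => obtain ⟨i, rfl⟩ := hx; simp [σ]
    | zero => simp
    | add x y hx hy ihx ihy =>
      rw [← homogeneousSubmodule_one_eq_span_X] at hx hy
      rw [map_add, ihx hx, ihy hy, map_add, map_add]; ring
    | smul t x hx ihx =>
      rw [← homogeneousSubmodule_one_eq_span_X] at hx
      rw [map_smul, ihx hx, map_smul, smul_eq_mul, map_mul, smul_eq_C_mul, smul_eq_C_mul]; ring
  refine ⟨σ, lam, ?_, ?_, hlin⟩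
  · rw [hlin c hc, hlam]; simp
  · intro f
    induction f using MvPolynomial.induction_on with
    | C a => simp [σ]
    | add p q hp hq =>
      rw [map_add]
      convert dvd_add hp hq using 1; ring
    | mul_X p i hp =>
      have h2 : c ∣ X i - σ (X i) := by simp [σ]
      rw [map_mul]
      have : p * X i - σ p * σ (X i) = (p - σ p) * X i + σ p * (X i - σ (X i)) := by ring
      rw [this]
      exact dvd_add (hp.mul_right _) (h2.mul_left _)

lemma prime_linear {K : Type*} [Field K] (c f g : MvPolynomial (Fin 4) K)
    (hc : c.IsHomogeneous 1) (hc0 : c ≠ 0) (h : c ∣ f * g) : c ∣ f ∨ c ∣ g := by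
  obtain ⟨σ, lam, h1, h2, h3⟩ := exists_retraction c hc hc0
  have : σ f * σ g = 0 := by
    obtain ⟨k, hk⟩ := h
    rw [← map_mul, hk, map_mul, h1, zero_mul]
  rcases mul_eq_zero.1 this with h | h
  · left; have := h2 f; rwa [h, sub_zero] at this
  · right; have := h2 g; rwa [h, sub_zero] at this

lemma linear_dvd {K : Type*} [Field K] (c f : MvPolynomial (Fin 4) K)
    (hc : c.IsHomogeneous 1) (hf : f.IsHomogeneous 1) (hc0 : c ≠ 0) (h : c ∣ f) :
    ∃ t : K, f = C t * c := by
  obtain ⟨σ, lam, h1, h2, h3⟩ := exists_retraction c hc hc0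
  refine ⟨lam f, ?_⟩
  have h4 := h3 f hf
  obtain ⟨k, rfl⟩ := h
  rw [map_mul, h1, zero_mul] at h4
  exact (sub_eq_zero.1 h4.symm)

/-- Two independent linear forms have only the Koszul syzygy. -/
lemma koszul_two {K : Type*} [Field K] (a b f g : MvPolynomial (Fin 4) K)
    (ha : a.IsHomogeneous 1) (hb : b.IsHomogeneous 1) (ha0 : a ≠ 0)
    (hab : ∀ t : K, b ≠ C t * a) (h : a * f + b * g = 0) :
    ∃ m, g = a * m ∧ f = - (b * m) := by
  have h1 : a ∣ b * g := ⟨-f, by linear_combination h⟩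
  rcases prime_linear a b g ha ha0 h1 with h2 | ⟨m, hm⟩
  · obtain ⟨t, ht⟩ := linear_dvd a b ha hb ha0 h2
    exact absurd ht (hab t)
  · refine ⟨m, hm, ?_⟩
    subst hm
    apply mul_left_cancel₀ ha0
    linear_combination h

lemma hom_comp_mul {K : Type*} [Field K] (a m : MvPolynomial (Fin 4) K)
    (ha : a.IsHomogeneous 1) :
    homogeneousComponent 2 (a * m) = a * homogeneousComponent 1 m := by
  have h1 : m = ∑ i ∈ Finset.range (m.totalDegree + 1), homogeneousComponent i m :=
    (sum_homogeneousComponent m).symm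
  have h2 : ∀ i, homogeneousComponent 2 (a * homogeneousComponent i m) =
      if i = 1 then a * homogeneousComponent 1 m else 0 := by
    intro i
    have h3 : a * homogeneousComponent i m ∈ homogeneousSubmodule (Fin 4) K (1 + i) :=
      ha.mul (homogeneousComponent_isHomogeneous i m)
    rw [homogeneousComponent_of_mem h3]
    by_cases hi : i = 1
    · subst hi; simp
    · rw [if_neg hi, if_neg (by omega)]
  conv_lhs => rw [h1]
  rw [Finset.mul_sum, map_sum, Finset.sum_congr rfl (fun i _ => h2 i), Finset.sum_ite_eq']
  split_ifs with h
  · rfl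
  · rw [homogeneousComponent_eq_zero 1 m (by simp at h; omega), mul_zero]

lemma hom_comp_self {K : Type*} [Field K] (q : MvPolynomial (Fin 4) K)
    (hq : q.IsHomogeneous 2) : homogeneousComponent 2 q = q :=
  homogeneousComponent_eq_self hq

lemma koszul_three {K : Type*} [Field K] (a b c q1 q2 q3 : MvPolynomial (Fin 4) K)
    (ha : a.IsHomogeneous 1) (hb : b.IsHomogeneous 1) (hc : c.IsHomogeneous 1)
    (hq1 : q1.IsHomogeneous 2) (hq2 : q2.IsHomogeneous 2) (hq3 : q3.IsHomogeneous 2)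
    (hind : ∀ r s t : K, C r * a + C s * b + C t * c = 0 → r = 0 ∧ s = 0 ∧ t = 0)
    (h : a * q1 + b * q2 + c * q3 = 0) :
    ∃ m1 m2 m3 : MvPolynomial (Fin 4) K, m1.IsHomogeneous 1 ∧ m2.IsHomogeneous 1 ∧
      m3.IsHomogeneous 1 ∧ q1 = b * m3 - c * m2 ∧ q2 = c * m1 - a * m3 ∧
      q3 = a * m2 - b * m1 := by
  have hc0 : c ≠ 0 := by
    rintro rfl
    have := hind 0 0 1 (by simp)
    simp at this
  obtain ⟨σ, lam, h1, h2, h3⟩ := exists_retraction c hc hc0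
  have hσ : σ a * σ q1 + σ b * σ q2 = 0 := by
    have := congrArg σ h
    simpa [h1] using this
  have hσa : σ a = a - C (lam a) * c := h3 a ha
  have hσb : σ b = b - C (lam b) * c := h3 b hb
  have hla : (σ a).IsHomogeneous 1 := by rw [hσa]; exact ha.sub (hc.C_mul _)
  have hlb : (σ b).IsHomogeneous 1 := by rw [hσb]; exact hb.sub (hc.C_mul _)
  have ha0 : σ a ≠ 0 := by
    intro h0
    have := hind 1 0 (- lam a) (by rw [hσa] at h0; simp; linear_combination h0)
    simp at this
  have hab : ∀ t : K, σ b ≠ C t * σ a := by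
    intro t h0
    rw [hσa, hσb] at h0
    have := hind (-t) 1 (t * lam a - lam b) (by simp; linear_combination h0)
    simp at this
  obtain ⟨m, hm2, hm1⟩ := koszul_two _ _ _ _ hla hlb ha0 hab hσ
  obtain ⟨n1, hn1⟩ := h2 q1
  obtain ⟨n2, hn2⟩ := h2 q2
  rw [hm1, hσb] at hn1
  rw [hm2, hσa] at hn2
  -- q1 = -b m + c (n1 + lam b m), q2 = a m + c (n2 - lam a m)
  have e1 : q1 = b * (-m) - c * (-(n1 + C (lam b) * m)) := by linear_combination hn1
  have e2 : q2 = c * (n2 - C (lam a) * m) - a * (-m) := by linear_combination hn2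
  have e3 : q3 = a * (-(n1 + C (lam b) * m)) - b * (n2 - C (lam a) * m) := by
    apply mul_left_cancel₀ hc0
    linear_combination h - a * e1 - b * e2
  refine ⟨_, _, _, homogeneousComponent_isHomogeneous 1 (n2 - C (lam a) * m),
    homogeneousComponent_isHomogeneous 1 (-(n1 + C (lam b) * m)),
    homogeneousComponent_isHomogeneous 1 (-m), ?_, ?_, ?_⟩
  · rw [← hom_comp_mul _ _ hb, ← hom_comp_mul _ _ hc, ← map_sub, ← e1, hom_comp_self _ hq1]
  · rw [← hom_comp_mul _ _ ha, ← hom_comp_mul _ _ hc, ← map_sub, ← e2, hom_comp_self _ hq2]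
  · rw [← hom_comp_mul _ _ ha, ← hom_comp_mul _ _ hb, ← map_sub, ← e3, hom_comp_self _ hq3]

/-- A spanning triple of a 3-dimensional space is linearly independent. -/
lemma triple_indep {K : Type*} [Field K]
    (V : Submodule K (MvPolynomial (Fin 4) K)) (hVdim : Module.finrank K V = 3)
    (q : Fin 3 → MvPolynomial (Fin 4) K) (hq : V = Submodule.span K (Set.range q)) :
    LinearIndependent K q := by
  rw [linearIndependent_iff_card_eq_finrank_span, Set.finrank, ← hq, hVdim]
  simp

/-- The syzygy condition in coordinates. -/
lemma syz_coord {K : Type*} [Field K]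
    (V : Submodule K (MvPolynomial (Fin 4) K)) (hVdim : Module.finrank K V = 3)
    (hker : Module.rank K (LinearMap.ker (mulMap V)) = 1)
    (q1 q2 q3 : MvPolynomial (Fin 4) K)
    (hq : V = Submodule.span K (Set.range ![q1, q2, q3])) :
    ∃ a b c : MvPolynomial (Fin 4) K, a.IsHomogeneous 1 ∧ b.IsHomogeneous 1 ∧
      c.IsHomogeneous 1 ∧ a * q1 + b * q2 + c * q3 = 0 ∧ ¬ (a = 0 ∧ b = 0 ∧ c = 0) ∧
      ∀ a' b' c' : MvPolynomial (Fin 4) K, a'.IsHomogeneous 1 → b'.IsHomogeneous 1 →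
        c'.IsHomogeneous 1 → a' * q1 + b' * q2 + c' * q3 = 0 →
        ∃ k : K, a' = C k * a ∧ b' = C k * b ∧ c' = C k * c := by
  have hli := triple_indep V hVdim _ hq
  subst hq
  let B := Module.Basis.span hli
  let e := TensorProduct.equivFinsuppOfBasisRight (M := homogeneousSubmodule (Fin 4) K 1) B
  have hmul : ∀ f : Fin 3 →₀ homogeneousSubmodule (Fin 4) K 1,
      mulMap _ (e.symm f) = (f 0 : MvPolynomial (Fin 4) K) * q1 + f 1 * q2 + f 2 * q3 := by
    intro f
    simp only [e, TensorProduct.equivFinsuppOfBasisRight_symm_apply]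
    rw [Finsupp.sum_fintype _ _ (by simp)]
    simp [mulMap, Fin.sum_univ_three, B, Module.Basis.span_apply]
  have hfr : Module.finrank K
      (LinearMap.ker (mulMap (Submodule.span K (Set.range ![q1, q2, q3])))) = 1 := by
    rw [Module.finrank, hker]; simp
  obtain ⟨⟨v, hv⟩, hv0, hspan⟩ : ∃ v : LinearMap.ker
      (mulMap (Submodule.span K (Set.range ![q1, q2, q3]))), v ≠ 0 ∧
      ∀ w : LinearMap.ker (mulMap (Submodule.span K (Set.range ![q1, q2, q3]))),
        ∃ k : K, k • v = w := by
    letI : AddCommGroup (LinearMap.ker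
      (mulMap (Submodule.span K (Set.range ![q1, q2, q3])))) :=
      Module.addCommMonoidToAddCommGroup K
    exact finrank_eq_one_iff'.1 hfr
  replace hv0 : v ≠ 0 := fun h => hv0 (Subtype.ext h)
  have hvf : v = e.symm (e v) := by simp
  refine ⟨e v 0, e v 1, e v 2, (e v 0).2, (e v 1).2, (e v 2).2, ?_, ?_, ?_⟩
  · rw [← hmul, ← hvf]; exact hv
  · rintro ⟨h0, h1, h2⟩
    apply hv0
    apply e.injective
    ext i : 2
    fin_cases i <;> simp [h0, h1, h2]
  · intro a' b' c' ha' hb' hc' h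
    let f : Fin 3 →₀ homogeneousSubmodule (Fin 4) K 1 :=
      Finsupp.equivFunOnFinite.symm ![⟨a', ha'⟩, ⟨b', hb'⟩, ⟨c', hc'⟩]
    have hf : e.symm f ∈ LinearMap.ker (mulMap _) := by
      rw [LinearMap.mem_ker, hmul]
      simpa [f] using h
    obtain ⟨k, hk⟩ := hspan ⟨_, hf⟩
    replace hk : k • v = e.symm f := congrArg Subtype.val hk
    have hk' : f = k • e v := by
      rw [← map_smul, hk]; simp
    refine ⟨k, ?_, ?_, ?_⟩
    · have := congrArg (fun g => ((g 0 : homogeneousSubmodule (Fin 4) K 1) :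
        MvPolynomial (Fin 4) K)) hk'
      simpa [f, smul_eq_C_mul] using this
    · have := congrArg (fun g => ((g 1 : homogeneousSubmodule (Fin 4) K 1) :
        MvPolynomial (Fin 4) K)) hk'
      simpa [f, smul_eq_C_mul] using this
    · have := congrArg (fun g => ((g 2 : homogeneousSubmodule (Fin 4) K 1) :
        MvPolynomial (Fin 4) K)) hk'
      simpa [f, smul_eq_C_mul] using this

/-- The case where the syzygy only involves two of the quadrics. -/
lemma core_case {K : Type*} [Field K]
    (V : Submodule K (MvPolynomial (Fin 4) K))
    (hV2 : V ≤ homogeneousSubmodule (Fin 4) K 2) (hVdim : Module.finrank K V = 3)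
    (hker : Module.rank K (LinearMap.ker (mulMap V)) = 1)
    (q1 q2 q3 : MvPolynomial (Fin 4) K)
    (hq : V = Submodule.span K (Set.range ![q1, q2, q3]))
    (a b : MvPolynomial (Fin 4) K) (ha : a.IsHomogeneous 1) (hb : b.IsHomogeneous 1)
    (hab0 : ¬ (a = 0 ∧ b = 0)) (h : a * q1 + b * q2 = 0) :
    ∃ (ℓ : MvPolynomial (Fin 4) K) (U : Submodule K (MvPolynomial (Fin 4) K))
      (h : MvPolynomial (Fin 4) K),
      ℓ.IsHomogeneous 1 ∧ ℓ ≠ 0 ∧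
      U ≤ homogeneousSubmodule (Fin 4) K 1 ∧ Module.finrank K U = 2 ∧
      h.IsHomogeneous 2 ∧
      V = U.map (LinearMap.mulLeft K ℓ) ⊔ Submodule.span K {h} ∧
      ¬ ℓ ∣ h ∧ ∀ u ∈ U, u ≠ 0 → ¬ u ∣ h := by
  have hli := triple_indep V hVdim _ hq
  have hli' : ∀ r s t : K, C r * q1 + C s * q2 + C t * q3 = 0 → r = 0 ∧ s = 0 ∧ t = 0 := by
    intro r s t hrst
    have := Fintype.linearIndependent_iff.1 hli ![r, s, t]
      (by simpa [Fin.sum_univ_three, smul_eq_C_mul] using hrst)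
    exact ⟨this 0, this 1, this 2⟩
  have hmem : ∀ i, ![q1, q2, q3] i ∈ V := fun i => by
    rw [hq]; exact Submodule.subset_span ⟨i, rfl⟩
  have hq1 : q1.IsHomogeneous 2 := hV2 (hmem 0)
  have hq2 : q2.IsHomogeneous 2 := hV2 (hmem 1)
  have hq3 : q3.IsHomogeneous 2 := hV2 (hmem 2)
  have ha0 : a ≠ 0 := by
    rintro rfl
    have hb0 : b ≠ 0 := fun h0 => hab0 ⟨rfl, h0⟩
    have : q2 = 0 := by simpa [hb0] using h
    have := hli' 0 1 0 (by simp [this])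
    simp at this
  have hab : ∀ t : K, b ≠ C t * a := by
    rintro t rfl
    have h0 : a * (q1 + C t * q2) = 0 := by linear_combination h
    have := hli' 1 t 0 (by simpa [ha0] using h0)
    simp at this
  obtain ⟨m', hm2', hm1'⟩ := koszul_two a b q1 q2 ha hb ha0 hab h
  obtain ⟨m, hm, hm2, hm1⟩ : ∃ m : MvPolynomial (Fin 4) K, m.IsHomogeneous 1 ∧
      q2 = a * m ∧ q1 = -(b * m) := by
    refine ⟨_, homogeneousComponent_isHomogeneous 1 m', ?_, ?_⟩
    · rw [← hom_comp_mul _ _ ha, ← hm2', hom_comp_self _ hq2]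
    · rw [← hom_comp_mul _ _ hb, ← map_neg, ← hm1', hom_comp_self _ hq1]
  have hm0 : m ≠ 0 := by
    rintro rfl
    have := hli' 0 1 0 (by simp [hm2])
    simp at this
  have hb0 : b ≠ 0 := by
    intro h0; exact hab 0 (by simp [h0])
  -- the uniqueness of the syzygy, in the form: every syzygy has zero last entry
  have huniq : ∀ a' b' c' : MvPolynomial (Fin 4) K, a'.IsHomogeneous 1 → b'.IsHomogeneous 1 →
        c'.IsHomogeneous 1 → a' * q1 + b' * q2 + c' * q3 = 0 → c' = 0 := by
    obtain ⟨a0, b0, c0, hA, hB, hC, hs, hne, huni⟩ := syz_coord V hVdim hker q1 q2 q3 hq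
    obtain ⟨k, k1, k2, k3⟩ := huni a b 0 ha hb (isHomogeneous_zero _ _ _) (by simpa using h)
    have hk : k ≠ 0 := by
      rintro rfl
      simp at k1; exact ha0 k1
    have hc0 : c0 = 0 := by simpa [hk] using k3
    intro a' b' c' ha' hb' hc' h'
    obtain ⟨k, k1, k2, k3⟩ := huni a' b' c' ha' hb' hc' h'
    simp [k3, hc0]
  have hU : LinearIndependent K ![a, b] := by
    rw [LinearIndependent.pair_iff' ha0]
    intro t ht
    exact hab t (by rw [← ht, smul_eq_C_mul])
  refine ⟨m, Submodule.span K (Set.range ![a, b]), q3, hm, hm0, ?_, ?_, hq3, ?_, ?_, ?_⟩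
  · rw [Submodule.span_le]
    rintro _ ⟨i, rfl⟩
    fin_cases i
    · exact ha
    · exact hb
  · rw [finrank_span_eq_card hU]; simp
  · rw [hq, Submodule.map_span, ← Submodule.span_union]
    apply le_antisymm
    · rw [Submodule.span_le]
      rintro _ ⟨i, rfl⟩
      fin_cases i
      · have : q1 = -(LinearMap.mulLeft K m b) := by simp [hm1]; ring
        change q1 ∈ _
        rw [this]
        exact Submodule.neg_mem _ (Submodule.subset_span (Or.inl ⟨b, ⟨1, rfl⟩, rfl⟩))
      · have : q2 = LinearMap.mulLeft K m a := by simp [hm2]; ring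
        change q2 ∈ _
        rw [this]
        exact Submodule.subset_span (Or.inl ⟨a, ⟨0, rfl⟩, rfl⟩)
      · exact Submodule.subset_span (Or.inr rfl)
    · rw [Submodule.span_le]
      rintro _ (⟨_, ⟨i, rfl⟩, rfl⟩ | hx)
      · fin_cases i
        · have : LinearMap.mulLeft K m a = q2 := by simp [hm2]; ring
          change LinearMap.mulLeft K m a ∈ _
          rw [this, ← hq]; exact hmem 1
        · have : LinearMap.mulLeft K m b = -q1 := by simp [hm1]; ring
          change LinearMap.mulLeft K m b ∈ _
          rw [this, ← hq]; exact V.neg_mem (hmem 0)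
      · rw [Set.mem_singleton_iff.1 hx, ← hq]; exact hmem 2
  · rintro ⟨n', hn'⟩
    have hn : q3 = m * homogeneousComponent 1 n' := by
      rw [← hom_comp_mul _ _ hm, ← hn', hom_comp_self _ hq3]
    refine hb0 (huniq (homogeneousComponent 1 n') 0 b
      (homogeneousComponent_isHomogeneous _ _) (isHomogeneous_zero _ _ _) hb ?_)
    rw [hn, hm1]; ring
  · rintro u hu hu0 ⟨n', hn'⟩
    have hu' : ∃ s t : K, u = C s * a + C t * b := by
      have : u ∈ Submodule.span K {a, b} := by
        simpa [Set.pair_comm] using hu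
      obtain ⟨s, t, rfl⟩ := Submodule.mem_span_pair.1 this
      exact ⟨s, t, by simp [smul_eq_C_mul]⟩
    obtain ⟨s, t, hst⟩ := hu'
    have hul : u.IsHomogeneous 1 := by
      rw [hst]; exact (ha.C_mul _).add (hb.C_mul _)
    have hn : q3 = u * homogeneousComponent 1 n' := by
      rw [← hom_comp_mul _ _ hul, ← hn', hom_comp_self _ hq3]
    have hnl : (homogeneousComponent 1 n').IsHomogeneous 1 :=
      homogeneousComponent_isHomogeneous _ _
    refine hm0 (neg_eq_zero.1 (huniq (C (-t) * homogeneousComponent 1 n')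
      (C s * homogeneousComponent 1 n') (-m) (hnl.C_mul _) (hnl.C_mul _) hm.neg ?_))
    rw [hn, hm1, hm2, hst, map_neg]; ring

/-- Reduction of a dependent syzygy to the core case. -/
lemma dep_case {K : Type*} [Field K]
    (V : Submodule K (MvPolynomial (Fin 4) K))
    (hV2 : V ≤ homogeneousSubmodule (Fin 4) K 2) (hVdim : Module.finrank K V = 3)
    (hker : Module.rank K (LinearMap.ker (mulMap V)) = 1)
    (q1 q2 q3 : MvPolynomial (Fin 4) K)
    (hq : V = Submodule.span K {q1, q2, q3})
    (a b c : MvPolynomial (Fin 4) K) (ha : a.IsHomogeneous 1) (hb : b.IsHomogeneous 1)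
    (h0 : ¬ (a = 0 ∧ b = 0 ∧ c = 0)) (h : a * q1 + b * q2 + c * q3 = 0)
    (r s t : K) (ht : t ≠ 0) (hrst : C r * a + C s * b + C t * c = 0) :
    ∃ (ℓ : MvPolynomial (Fin 4) K) (U : Submodule K (MvPolynomial (Fin 4) K))
      (h : MvPolynomial (Fin 4) K),
      ℓ.IsHomogeneous 1 ∧ ℓ ≠ 0 ∧
      U ≤ homogeneousSubmodule (Fin 4) K 1 ∧ Module.finrank K U = 2 ∧
      h.IsHomogeneous 2 ∧
      V = U.map (LinearMap.mulLeft K ℓ) ⊔ Submodule.span K {h} ∧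
      ¬ ℓ ∣ h ∧ ∀ u ∈ U, u ≠ 0 → ¬ u ∣ h := by
  have hc : c = C (-(r / t)) * a + C (-(s / t)) * b := by
    have hCt : (C t : MvPolynomial (Fin 4) K) ≠ 0 := by simpa using ht
    apply mul_left_cancel₀ hCt
    have e1 : (C t : MvPolynomial (Fin 4) K) * C (-(r / t)) = - C r := by
      rw [← map_mul, ← map_neg]; congr 1; field_simp
    have e2 : (C t : MvPolynomial (Fin 4) K) * C (-(s / t)) = - C s := by
      rw [← map_mul, ← map_neg]; congr 1; field_simp
    linear_combination hrst - a * e1 - b * e2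
  generalize -(r / t) = α at hc
  generalize -(s / t) = β at hc
  refine core_case V hV2 hVdim hker (q1 + C α * q3) (q2 + C β * q3) q3 ?_ a b ha hb ?_ ?_
  · rw [hq]
    apply le_antisymm
    · rw [Submodule.span_le]
      have m0 := Submodule.subset_span (R := K)
        (Set.mem_range_self (f := ![q1 + C α * q3, q2 + C β * q3, q3]) 0)
      have m1 := Submodule.subset_span (R := K)
        (Set.mem_range_self (f := ![q1 + C α * q3, q2 + C β * q3, q3]) 1)
      have m2 := Submodule.subset_span (R := K)
        (Set.mem_range_self (f := ![q1 + C α * q3, q2 + C β * q3, q3]) 2)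
      rintro x (rfl | rfl | rfl)
      · have := Submodule.sub_mem _ m0 (Submodule.smul_mem _ α m2)
        simpa [smul_eq_C_mul] using this
      · have := Submodule.sub_mem _ m1 (Submodule.smul_mem _ β m2)
        simpa [smul_eq_C_mul] using this
      · exact m2
    · rw [Submodule.span_le]
      have m0 : q1 ∈ Submodule.span K {q1, q2, q3} := Submodule.subset_span (by simp)
      have m1 : q2 ∈ Submodule.span K {q1, q2, q3} := Submodule.subset_span (by simp)
      have m2 : q3 ∈ Submodule.span K {q1, q2, q3} := Submodule.subset_span (by simp)
      rintro _ ⟨i, rfl⟩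
      fin_cases i
      · have := Submodule.add_mem _ m0 (Submodule.smul_mem _ α m2)
        simpa [smul_eq_C_mul] using this
      · have := Submodule.add_mem _ m1 (Submodule.smul_mem _ β m2)
        simpa [smul_eq_C_mul] using this
      · exact m2
  · rintro ⟨rfl, rfl⟩
    exact h0 ⟨rfl, rfl, by simp [hc]⟩
  · rw [hc] at h
    linear_combination h

/-- If `V ⊆ R_2` is a net of quadrics in `R = K[w,x,y,z]`
(a 3-dimensional space of quadrics) whose space of linear syzygies — the kernel
of the multiplication map `R_1 ⊗ V → R_3` (here viewed as a map to `R`) — is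
exactly 1-dimensional, then `V = ℓ·U + K·h` for some linear form `ℓ`, some
2-dimensional space of linear forms `U`, and a quadric `h` divisible neither by
`ℓ` nor by any nonzero element of `U`. -/
theorem statement_4 {K : Type*} [Field K] [IsAlgClosed K] [CharZero K]
    (V : Submodule K (MvPolynomial (Fin 4) K))
    (hV2 : V ≤ homogeneousSubmodule (Fin 4) K 2)
    (hVdim : Module.finrank K V = 3)
    (hker : Module.rank K (LinearMap.ker (mulMap V)) = 1) :
    ∃ (ℓ : MvPolynomial (Fin 4) K) (U : Submodule K (MvPolynomial (Fin 4) K))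
      (h : MvPolynomial (Fin 4) K),
      ℓ.IsHomogeneous 1 ∧ ℓ ≠ 0 ∧
      U ≤ homogeneousSubmodule (Fin 4) K 1 ∧ Module.finrank K U = 2 ∧
      h.IsHomogeneous 2 ∧
      V = U.map (LinearMap.mulLeft K ℓ) ⊔ Submodule.span K {h} ∧
      ¬ ℓ ∣ h ∧ ∀ u ∈ U, u ≠ 0 → ¬ u ∣ h := by
  have hfd : FiniteDimensional K V := Module.finite_of_finrank_pos (by omega)
  let B := Module.finBasisOfFinrankEq K V hVdim
  have hspan : V = Submodule.span K (Set.range fun i => (B i : MvPolynomial (Fin 4) K)) := by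
    have := congrArg (Submodule.map V.subtype) B.span_eq
    rw [Submodule.map_span, Submodule.map_top, Submodule.range_subtype, ← Set.range_comp] at this
    exact this.symm
  obtain ⟨q1, q2, q3, hq⟩ : ∃ q1 q2 q3 : MvPolynomial (Fin 4) K,
      V = Submodule.span K (Set.range ![q1, q2, q3]) := by
    refine ⟨B 0, B 1, B 2, ?_⟩
    refine hspan.trans ?_
    congr 2
    funext i
    fin_cases i <;> rfl
  have hq' : V = Submodule.span K {q1, q2, q3} := by
    rw [hq]; congr 1; ext x; simp [eq_comm]; tauto
  have hli := triple_indep V hVdim _ hq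
  have hmem : ∀ i, ![q1, q2, q3] i ∈ V := fun i => by
    rw [hq]; exact Submodule.subset_span ⟨i, rfl⟩
  obtain ⟨a, b, c, ha, hb, hc, hs, hne, huni⟩ := syz_coord V hVdim hker q1 q2 q3 hq
  by_cases hind : ∀ r s t : K, C r * a + C s * b + C t * c = 0 → r = 0 ∧ s = 0 ∧ t = 0
  · exfalso
    obtain ⟨m1, m2, m3, h1, h2, h3, e1, e2, e3⟩ := koszul_three a b c q1 q2 q3 ha hb hc
      (hV2 (hmem 0)) (hV2 (hmem 1)) (hV2 (hmem 2)) hind hs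
    obtain ⟨k, k1, k2, k3⟩ := huni m1 m2 m3 h1 h2 h3 (by rw [e1, e2, e3]; ring)
    have : q1 = 0 := by rw [e1, k2, k3]; ring
    exact hli.ne_zero 0 this
  · push Not at hind
    obtain ⟨r, s, t, hrst, hnz⟩ := hind
    by_cases ht : t = 0
    · by_cases hs' : s = 0
      · have hr : r ≠ 0 := fun hr => hnz hr hs' ht
        refine dep_case V hV2 hVdim hker q2 q3 q1 ?_ b c a hb hc ?_ ?_ s t r hr ?_
        · rw [hq']; congr 1; ext x; simp; tauto
        · tauto
        · linear_combination hs
        · linear_combination hrst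
      · refine dep_case V hV2 hVdim hker q1 q3 q2 ?_ a c b ha hc ?_ ?_ r t s hs' ?_
        · rw [hq']; congr 1; ext x; simp; tauto
        · tauto
        · linear_combination hs
        · linear_combination hrst
    · exact dep_case V hV2 hVdim hker q1 q2 q3 hq' a b c ha hb hne hs r s t ht hrst

end
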